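/- arXiv:2305.06120 — 2 statements merged into one kernel-verified Lean document; each statement's English description precedes it below -/
import Mathlib

section
/- Let G be a finite simple graph, M* a maximum matching and M any matching in G. If |M*| > (1 + ε)·|M| for some ε > 0, then G contains an augmenting path with respect to M of length at most 4/ε + 1. -/
/-- A matching in a graph `G`: a finite set of edges of `G` that are pairwise
vertex-disjoint. -/
def IsMatching {V : Type*} (G : SimpleGraph V) (M : Finset (Sym2 V)) : Prop :=
  (∀ e ∈ M, e ∈ G.edgeSet) ∧
  ∀ e ∈ M, ∀ f ∈ M, e ≠ f → ∀ v : V, v ∈ e → v ∉ f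

/-- The list of consecutive edges of a list of vertices. -/
def pathEdges {V : Type*} (vs : List V) : List (Sym2 V) :=
  (vs.zip vs.tail).map fun p => s(p.1, p.2)

/-- A vertex unmatched by `M`. -/
def Unmatched {V : Type*} (M : Finset (Sym2 V)) (x : V) : Prop := ∀ e ∈ M, x ∉ e

/-- An augmenting path with respect to a matching `M`: a path
`v₀, v₁, …, v_{2ℓ+1}` in `G` whose edges alternate between non-matching edges
(at even positions) and matching edges (at odd positions), and whose two
endpoints are unmatched by `M`. -/
def IsAugPath {V : Type*} (G : SimpleGraph V) (M : Finset (Sym2 V)) (vs : List V) : Prop :=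
  2 ≤ vs.length ∧ vs.Nodup ∧ Even vs.length ∧
  (∀ e ∈ pathEdges vs, e ∈ G.edgeSet) ∧
  (∀ (i : ℕ) (h : i < (pathEdges vs).length), ((pathEdges vs).get ⟨i, h⟩ ∈ M ↔ Odd i)) ∧
  (∀ x ∈ vs.head?, Unmatched M x) ∧ (∀ x ∈ vs.getLast?, Unmatched M x)

/-- The partner involution of a matching. -/
lemma exists_partner {V : Type*} [Fintype V] [DecidableEq V] (G : SimpleGraph V)
    (M : Finset (Sym2 V)) (hM : IsMatching G M) :
    ∃ a : V → V, (∀ v, a (a v) = v) ∧ (∀ v, a v ≠ v → s(v, a v) ∈ M) ∧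
      (∀ v w, s(v, w) ∈ M → a v = w) ∧ (∀ v, a v = v → Unmatched M v) ∧
      (Finset.univ.filter (fun v => a v ≠ v)).card = 2 * M.card := by
  classical
  obtain ⟨h1, h2⟩ := hM
  have huniq : ∀ v w w', s(v, w) ∈ M → s(v, w') ∈ M → w = w' := by
    intro v w w' h h'
    by_contra hne
    have : s(v, w) ≠ s(v, w') := by
      intro h; exact hne (Sym2.congr_right.mp h)
    exact h2 _ h _ h' this v (Sym2.mem_mk_left _ _) (Sym2.mem_mk_left _ _)
  have hirr : ∀ v, s(v, v) ∉ M := by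
    intro v hv
    have := h1 _ hv
    simp at this
  let a : V → V := fun v => if h : ∃ w, s(v, w) ∈ M then h.choose else v
  have ha1 : ∀ v w, s(v, w) ∈ M → a v = w := by
    intro v w h
    have hex : ∃ w, s(v, w) ∈ M := ⟨w, h⟩
    have : a v = hex.choose := by simp only [a]; rw [dif_pos hex]
    rw [this]
    exact huniq _ _ _ hex.choose_spec h
  have ha2 : ∀ v, a v ≠ v → s(v, a v) ∈ M := by
    intro v hv
    by_cases hex : ∃ w, s(v, w) ∈ M
    · obtain ⟨w, hw⟩ := hex
      rw [ha1 _ _ hw]; exact hw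
    · exact absurd (by simp only [a]; rw [dif_neg hex]) hv
  have ha3 : ∀ v, a v = v → Unmatched M v := by
    intro v hv e he hve
    obtain ⟨w, rfl⟩ := hve
    have := ha1 _ _ he
    rw [hv] at this
    subst this
    exact hirr _ he
  refine ⟨a, ?_, ha2, ha1, ha3, ?_⟩
  · intro v
    by_cases hv : a v = v
    · rw [hv, hv]
    · apply ha1
      rw [Sym2.eq_swap]
      exact ha2 v hv
  · have : (Finset.univ.filter (fun v => a v ≠ v)) = M.biUnion Sym2.toFinset := by
      ext v
      simp only [Finset.mem_filter, Finset.mem_univ, true_and, Finset.mem_biUnion,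
        Sym2.mem_toFinset]
      constructor
      · intro hv
        exact ⟨_, ha2 v hv, Sym2.mem_mk_left _ _⟩
      · rintro ⟨e, he, hve⟩ hv
        exact ha3 v hv e he hve
    rw [this, Finset.card_biUnion]
    · rw [Finset.sum_congr rfl (g := fun _ => 2)]
      · simp [mul_comm]
      · intro e he
        exact Sym2.card_toFinset_of_not_isDiag e (G.not_isDiag_of_mem_edgeSet (h1 e he))
    · intro e he f hf hne
      rw [Function.onFun, Finset.disjoint_left]
      intro v hv hv'
      rw [Sym2.mem_toFinset] at hv hv'
      exact h2 e he f hf hne v hv hv'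

/-- Counting: many disjoint alternating trajectories. -/
lemma counting {V : Type*} [Fintype V] [DecidableEq V] (a b : V → V)
    (ha : ∀ v, a (a v) = v) (hb : ∀ v, b (b v) = v) (L : ℕ)
    (hno : ∀ x, b x ≠ x → a x = x → ∀ l ≤ L,
      (∀ i ≤ l, b ((fun v => a (b v))^[i] x) ≠ (fun v => a (b v))^[i] x) →
      a (b ((fun v => a (b v))^[l] x)) ≠ b ((fun v => a (b v))^[l] x)) :
    (Finset.univ.filter (fun v => b v ≠ v)).card * (L + 1) ≤
      (Finset.univ.filter (fun v => a v ≠ v)).card * (L + 1) +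
      (Finset.univ.filter (fun v => a v ≠ v)).card := by
  classical
  set f : V → V := fun v => a (b v) with hf
  have hfinj : Function.Injective f := by
    intro u v h
    have h' := congrArg a h
    simp only [hf, ha] at h'
    have h'' := congrArg b h'
    simpa only [hb] using h''
  have hgoodA : ∀ x, b x ≠ x → a x = x → ∀ j, 1 ≤ j → j ≤ L + 1 →
      (∀ i < j, b (f^[i] x) ≠ f^[i] x) → a (f^[j] x) ≠ f^[j] x := by
    intro x hbx hax j hj1 hj2 hg
    obtain ⟨k, rfl⟩ : ∃ k, j = k + 1 := ⟨j - 1, by omega⟩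
    have h := hno x hbx hax k (by omega) (fun i hi => hg i (by omega))
    rw [Function.iterate_succ_apply']
    change a (a (b (f^[k] x))) ≠ a (b (f^[k] x))
    rw [ha]
    exact h.symm
  have key : ∀ x x', b x ≠ x → a x = x → b x' ≠ x' → a x' = x' → ∀ i j, i ≤ j → j ≤ L + 1 →
      (∀ k < j, b (f^[k] x') ≠ f^[k] x') → f^[i] x = f^[j] x' → i = j ∧ x = x' := by
    intro x x' hbx hax hbx' hax' i j hij hj hg he
    obtain ⟨d, rfl⟩ := Nat.exists_eq_add_of_le hij
    rw [Function.iterate_add_apply] at he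
    have hx := hfinj.iterate i he
    rcases Nat.eq_zero_or_pos d with rfl | hd
    · exact ⟨rfl, hx⟩
    · exfalso
      apply hgoodA x' hbx' hax' d hd (by omega) (fun k hk => hg k (by omega))
      rw [← hx]; exact hax
  let A := Finset.univ.filter (fun v => a v ≠ v)
  let B := Finset.univ.filter (fun v => b v ≠ v)
  let U := B \ A
  let W := A \ B
  have hU : ∀ x, x ∈ U ↔ b x ≠ x ∧ a x = x := by intro x; simp [U, A, B]
  have hW : ∀ x, x ∈ W ↔ a x ≠ x ∧ b x = x := by intro x; simp [W, A, B]
  let T := U.filter (fun x => ∀ i < L + 1, b (f^[i] x) ≠ f^[i] x)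
  let T' := U.filter (fun x => ¬ ∀ i < L + 1, b (f^[i] x) ≠ f^[i] x)
  have hTT : T.card + T'.card = U.card := Finset.card_filter_add_card_filter_not _
  have h1 : T.card * (L + 1) ≤ A.card := by
    have : (T ×ˢ Finset.range (L + 1)).card ≤ A.card := by
      apply Finset.card_le_card_of_injOn (fun p => f^[p.2 + 1] p.1)
      · rintro ⟨x, j⟩ hp
        simp only [Finset.coe_product, Set.mem_prod, Finset.mem_coe, T, Finset.mem_filter,
          hU, Finset.mem_range] at hp
        obtain ⟨⟨⟨h1, h2⟩, h3⟩, h4⟩ := hp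
        simp only [A, Finset.coe_filter, Finset.mem_univ, true_and, Set.mem_ofPred_eq]
        exact hgoodA x h1 h2 (j + 1) (by omega) (by omega) (fun i hi => h3 i (by omega))
      · rintro ⟨x, j⟩ hp ⟨x', j'⟩ hp' he
        simp only [Finset.coe_product, Set.mem_prod, Finset.mem_coe, T, Finset.mem_filter,
          hU, Finset.mem_range] at hp hp'
        obtain ⟨⟨⟨h1, h2⟩, h3⟩, h4⟩ := hp
        obtain ⟨⟨⟨h1', h2'⟩, h3'⟩, h4'⟩ := hp'
        simp only at he h4 h4'
        rcases le_total j j' with hjj | hjj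
        · obtain ⟨e1, e2⟩ := key x x' h1 h2 h1' h2' (j + 1) (j' + 1) (by omega) (by omega)
            (fun i hi => h3' i (by omega)) he
          ext
          · exact e2
          · simp only; omega
        · obtain ⟨e1, e2⟩ := key x' x h1' h2' h1 h2 (j' + 1) (j + 1) (by omega) (by omega)
            (fun i hi => h3 i (by omega)) he.symm
          ext
          · exact e2.symm
          · simp only; omega
    simpa using this
  have h2 : T'.card ≤ W.card := by
    have hex : ∀ x ∈ T', ∃ i, i < L + 1 ∧ b (f^[i] x) = f^[i] x ∧
        ∀ k < i, b (f^[k] x) ≠ f^[k] x := by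
      intro x hx
      simp only [T', Finset.mem_filter] at hx
      obtain ⟨-, hx⟩ := hx
      push Not at hx
      have hs := Nat.find_spec hx
      refine ⟨Nat.find hx, hs.1, hs.2, ?_⟩
      intro k hk hk'
      exact Nat.find_min hx hk ⟨by omega, hk'⟩
    choose! n hn1 hn2 hn3 using hex
    apply Finset.card_le_card_of_injOn (fun x => f^[n x] x)
    · intro x hx
      have hx' := (Finset.mem_filter.mp hx).1
      rw [hU] at hx'
      have hn2' := hn2 x hx
      rw [Finset.mem_coe, hW]
      refine ⟨?_, hn2'⟩
      apply hgoodA x hx'.1 hx'.2 _ _ (le_of_lt (hn1 x hx)) (hn3 x hx)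
      by_contra h0
      have h0' : n x = 0 := by omega
      rw [h0'] at hn2'
      exact hx'.1 hn2'
    · intro x hx x' hx' he
      have hxU := (hU x).mp (Finset.mem_filter.mp hx).1
      have hxU' := (hU x').mp (Finset.mem_filter.mp hx').1
      rcases le_total (n x) (n x') with hjj | hjj
      · exact (key x x' hxU.1 hxU.2 hxU'.1 hxU'.2 _ _ hjj (le_of_lt (hn1 x' hx'))
          (hn3 x' hx') he).2
      · exact (key x' x hxU'.1 hxU'.2 hxU.1 hxU.2 _ _ hjj (le_of_lt (hn1 x hx))
          (hn3 x hx) he.symm).2.symm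
  have h3 : U.card + (B ∩ A).card = B.card := Finset.card_sdiff_add_card_inter _ _
  have h4 : W.card + (A ∩ B).card = A.card := Finset.card_sdiff_add_card_inter _ _
  rw [Finset.inter_comm] at h4
  change B.card * (L + 1) ≤ A.card * (L + 1) + A.card
  nlinarith [Nat.mul_le_mul_right (L + 1) h2]

/-- Building an augmenting path from a sequence of vertices. -/
lemma isAugPath_of_seq {V : Type*} (G : SimpleGraph V) (M : Finset (Sym2 V)) (p : ℕ → V) (l : ℕ)
    (hinj : ∀ i < 2 * l + 2, ∀ j < 2 * l + 2, p i = p j → i = j)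
    (hadj : ∀ i < 2 * l + 1, s(p i, p (i + 1)) ∈ G.edgeSet)
    (halt : ∀ i < 2 * l + 1, (s(p i, p (i + 1)) ∈ M ↔ Odd i))
    (h0 : Unmatched M (p 0)) (hl : Unmatched M (p (2 * l + 1))) :
    IsAugPath G M ((List.range (2 * l + 2)).map p) := by
  have hlen : (pathEdges ((List.range (2 * l + 2)).map p)).length = 2 * l + 1 := by
    simp [pathEdges]
  have hget : ∀ (i : ℕ) (h : i < (pathEdges ((List.range (2 * l + 2)).map p)).length),
      (pathEdges ((List.range (2 * l + 2)).map p))[i] = s(p i, p (i + 1)) := by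
    intro i h
    simp [pathEdges]
  refine ⟨by simp, ?_, ?_, ?_, ?_, ?_, ?_⟩
  · apply List.Nodup.map_on _ List.nodup_range
    intro i hi j hj h
    exact hinj i (List.mem_range.mp hi) j (List.mem_range.mp hj) h
  · simp [parity_simps]
  · intro e he
    obtain ⟨i, hi, rfl⟩ := List.getElem_of_mem he
    rw [hget]
    exact hadj i (by omega)
  · intro i h
    rw [List.get_eq_getElem, hget i h]
    exact halt i (by omega)
  · intro x hx
    simp [List.head?_range] at hx
    subst hx; exact h0
  · intro x hx
    simp [List.getLast?_range] at hx
    subst hx; exact hl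

/-- An alternating trajectory that ends at an unmatched vertex is an augmenting path. -/
lemma exists_aug {V : Type*} (G : SimpleGraph V) (N M : Finset (Sym2 V))
    (hN : ∀ e ∈ N, e ∈ G.edgeSet) (hM : ∀ e ∈ M, e ∈ G.edgeSet) (a b : V → V)
    (ha : ∀ v, a (a v) = v) (hb : ∀ v, b (b v) = v)
    (haM : ∀ v, a v ≠ v → s(v, a v) ∈ M) (hMa : ∀ v w, s(v, w) ∈ M → a v = w)
    (hau : ∀ v, a v = v → Unmatched M v)
    (hbN : ∀ v, b v ≠ v → s(v, b v) ∈ N)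
    (x : V) (hax : a x = x) (l : ℕ)
    (hB : ∀ i ≤ l, b ((fun v => a (b v))^[i] x) ≠ (fun v => a (b v))^[i] x)
    (hA : ∀ i < l, a (b ((fun v => a (b v))^[i] x)) ≠ b ((fun v => a (b v))^[i] x))
    (hend : a (b ((fun v => a (b v))^[l] x)) = b ((fun v => a (b v))^[l] x)) :
    ∃ vs : List V, IsAugPath G M vs ∧ vs.length = 2 * l + 2 := by
  set f : V → V := fun v => a (b v) with hf
  have hfinj : Function.Injective f := by
    intro u v h
    have h' := congrArg a h
    simp only [hf, ha] at h'
    have h'' := congrArg b h'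
    simpa only [hb] using h''
  obtain ⟨X, hX⟩ : ∃ X : ℕ → V, X = fun i => f^[i] x := ⟨_, rfl⟩
  have hX0 : X 0 = x := by simp [hX]
  have hXs : ∀ i, X (i + 1) = a (b (X i)) := by
    intro i; simp only [hX, Function.iterate_succ_apply', hf]
  have hB' : ∀ i ≤ l, b (X i) ≠ X i := by rw [hX]; exact hB
  have hA' : ∀ i < l, a (b (X i)) ≠ b (X i) := by rw [hX]; exact hA
  have hend' : a (b (X l)) = b (X l) := by rw [hX]; exact hend
  have haX : ∀ i, a (X (i + 1)) = b (X i) := by intro i; rw [hXs, ha]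
  -- distinctness
  have hXinj1 : ∀ i d, i + d ≤ l → X i = X (i + d) → d = 0 := by
    intro i d hid h
    by_contra hd
    simp only [hX] at h
    rw [Function.iterate_add_apply] at h
    have h' : x = X d := by rw [hX]; exact hfinj.iterate i h
    obtain ⟨k, rfl⟩ := Nat.exists_eq_succ_of_ne_zero hd
    have h1 := haX k
    have h2 := hA' k (by omega)
    rw [Nat.succ_eq_add_one] at h'
    rw [← h', hax] at h1
    apply h2
    rw [← h1, hax]
  have hXinj : ∀ i ≤ l, ∀ j ≤ l, X i = X j → i = j := by
    intro i hi j hj h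
    rcases le_total i j with hij | hij
    · obtain ⟨d, rfl⟩ := Nat.exists_eq_add_of_le hij
      have := hXinj1 i d hj h; omega
    · obtain ⟨d, rfl⟩ := Nat.exists_eq_add_of_le hij
      have := hXinj1 j d hi h.symm; omega
  have hXY1 : ∀ d j, j + d ≤ l → X (j + d) ≠ b (X j) := by
    intro d
    induction d using Nat.strong_induction_on with
    | _ d ih =>
      intro j hj h
      match d, ih, hj, h with
      | 0, _, hj, h => exact hB' j (by omega) h.symm
      | 1, _, hj, h =>
        rw [hXs] at h
        exact hA' j (by omega) h
      | e + 2, ih, hj, h =>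
        apply ih e (by omega) (j + 1) (by omega)
        have h1 := congrArg a h
        rw [← hXs, show j + (e + 2) = (j + 1 + e) + 1 by omega, haX] at h1
        rw [← h1, hb]
  have hXY : ∀ i ≤ l, ∀ j ≤ l, X i ≠ b (X j) := by
    intro i hi j hj h
    rcases le_total i j with hij | hij
    · obtain ⟨d, rfl⟩ := Nat.exists_eq_add_of_le hij
      apply hXY1 d i hj
      rw [h, hb]
    · obtain ⟨d, rfl⟩ := Nat.exists_eq_add_of_le hij
      exact hXY1 d j hi h
  obtain ⟨p, hp⟩ : ∃ p : ℕ → V, p = fun n => if n % 2 = 0 then X (n / 2) else b (X (n / 2)) :=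
    ⟨_, rfl⟩
  have hp0 : ∀ i, p (2 * i) = X i := by
    intro i; simp [hp]
  have hp1 : ∀ i, p (2 * i + 1) = b (X i) := by
    intro i
    have h1 : (2 * i + 1) % 2 = 1 := by omega
    have h2 : (2 * i + 1) / 2 = i := by omega
    simp [hp, h2]
  have hp2 : ∀ i, p (2 * i + 1 + 1) = X (i + 1) := by
    intro i; rw [← hp0]; congr 1
  refine ⟨_, isAugPath_of_seq G M p l ?_ ?_ ?_ ?_ ?_, by simp⟩
  · intro i hi j hj h
    rcases Nat.even_or_odd' i with ⟨u, rfl | rfl⟩ <;> rcases Nat.even_or_odd' j with ⟨v, rfl | rfl⟩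
    · rw [hp0, hp0] at h
      rw [hXinj u (by omega) v (by omega) h]
    · rw [hp0, hp1] at h
      exact absurd h (hXY u (by omega) v (by omega))
    · rw [hp0, hp1] at h
      exact absurd h.symm (hXY v (by omega) u (by omega))
    · rw [hp1, hp1] at h
      have h' := congrArg b h
      rw [hb, hb] at h'
      rw [hXinj u (by omega) v (by omega) h']
  · intro i hi
    rcases Nat.even_or_odd' i with ⟨u, rfl | rfl⟩
    · rw [hp0, hp1]
      exact hN _ (hbN _ (hB' u (by omega)))
    · rw [hp1, hp2, hXs]
      exact hM _ (haM _ (hA' u (by omega)))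
  · intro i hi
    rcases Nat.even_or_odd' i with ⟨u, rfl | rfl⟩
    · rw [hp0, hp1]
      refine ⟨fun h => ?_, fun h => by obtain ⟨k, hk⟩ := h; omega⟩
      exfalso
      have h1 := hMa _ _ h
      rcases Nat.eq_zero_or_pos u with rfl | hu
      · rw [hX0, hax] at h1
        apply hB' 0 (by omega)
        rw [hX0]; exact h1.symm
      · obtain ⟨k, rfl⟩ : ∃ k, u = k + 1 := ⟨u - 1, by omega⟩
        rw [haX] at h1
        have h' := congrArg b h1
        rw [hb, hb] at h'
        have := hXinj k (by omega) (k + 1) (by omega) h'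
        omega
    · rw [hp1, hp2, hXs]
      exact ⟨fun _ => ⟨u, rfl⟩, fun _ => haM _ (hA' u (by omega))⟩
  · rw [show (0 : ℕ) = 2 * 0 from rfl, hp0, hX0]
    exact hau _ hax
  · rw [hp1]
    exact hau _ hend'

/-- If `M*` is a maximum matching, `M` any matching and `|M*| > (1+ε)|M|`, then
there is an augmenting path w.r.t. `M` of length at most `4/ε + 1`. -/
theorem stmt0 {V : Type*} [Fintype V] [DecidableEq V] (G : SimpleGraph V)
    (Mstar M : Finset (Sym2 V)) (ε : ℝ) (hε : 0 < ε)
    (hMstar : IsMatching G Mstar)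
    (hmax : ∀ M' : Finset (Sym2 V), IsMatching G M' → M'.card ≤ Mstar.card)
    (hM : IsMatching G M)
    (hgt : (1 + ε) * (M.card : ℝ) < (Mstar.card : ℝ)) :
    ∃ vs : List V, IsAugPath G M vs ∧ ((vs.length : ℝ) - 1 ≤ 4 / ε + 1) := by
  classical
  obtain ⟨a, ha, haM, hMa, hau, hac⟩ := exists_partner G M hM
  obtain ⟨b, hb, hbN, hNb, hbu, hbc⟩ := exists_partner G Mstar hMstar
  have hpos : (0 : ℝ) ≤ 2 / ε := by positivity
  by_cases hno : ∀ x, b x ≠ x → a x = x → ∀ l ≤ ⌊2 / ε⌋₊,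
      (∀ i ≤ l, b ((fun v => a (b v))^[i] x) ≠ (fun v => a (b v))^[i] x) →
      a (b ((fun v => a (b v))^[l] x)) ≠ b ((fun v => a (b v))^[l] x)
  · exfalso
    have h := counting a b ha hb _ hno
    rw [hac, hbc] at h
    have hL := Nat.lt_floor_add_one (2 / ε)
    generalize ⌊2 / ε⌋₊ = L at h hL
    have h' : (2 * (Mstar.card : ℝ)) * (L + 1) ≤ 2 * M.card * (L + 1) + 2 * M.card := by
      exact_mod_cast h
    rw [div_lt_iff₀ hε] at hL
    have hm : (0 : ℝ) ≤ M.card := by positivity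
    have hLp : (0 : ℝ) < (L : ℝ) + 1 := by positivity
    have h1 := mul_lt_mul_of_pos_right hgt hLp
    nlinarith [mul_le_mul_of_nonneg_left hL.le hm]
  · push Not at hno
    obtain ⟨x, hbx, hax, hex⟩ := hno
    have hs := Nat.find_spec hex
    obtain ⟨hl1, hl2, hl3⟩ := hs
    have hmin : ∀ i < Nat.find hex,
        a (b ((fun v => a (b v))^[i] x)) ≠ b ((fun v => a (b v))^[i] x) := by
      intro i hi hi'
      exact Nat.find_min hex hi ⟨by omega, fun k hk => hl2 k (by omega), hi'⟩
    generalize Nat.find hex = l at hl1 hl2 hl3 hmin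
    obtain ⟨vs, hvs, hlen⟩ := exists_aug G Mstar M hMstar.1 hM.1 a b ha hb haM hMa hau hbN
      x hax l hl2 hmin hl3
    refine ⟨vs, hvs, ?_⟩
    rw [hlen]
    have h1 : (l : ℝ) ≤ 2 / ε := (Nat.le_floor_iff hpos).mp hl1
    have h2 : 4 / ε = 2 * (2 / ε) := by ring
    rw [h2]
    push_cast
    linarith
end

section
/- Let G be a finite simple graph with vertex set V, and let the vertices be processed in a uniformly random order; when a vertex is processed and no previously processed neighbor was added, it is added to the independent set S and removed with all its neighbors. Fix a vertex v and an integer d ≥ 1, and consider the first k processing steps. The probability that after k steps v is still present in the graph and has (current) degree at least d is at most (1 − d/n)^k, where n = |V|. -/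
/-- One step of the random greedy MIS process: if the processed vertex `u` is
still remaining, it joins the independent set and it together with all its
neighbors are removed. -/
def greedyStep {V : Type*} [Fintype V] [DecidableEq V] (G : SimpleGraph V)
    [DecidableRel G.Adj] (remaining : Finset V) (u : V) : Finset V :=
  if u ∈ remaining then remaining \ insert u (G.neighborFinset u) else remaining

/-- The set of vertices remaining after processing the first `k` vertices of
the order `σ` by the random greedy MIS process. -/
def remainingAfter {V : Type*} [Fintype V] [DecidableEq V] (G : SimpleGraph V)
    [DecidableRel G.Adj] (σ : Fin (Fintype.card V) ≃ V) (k : ℕ) : Finset V :=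
  ((List.ofFn fun i => σ i).take k).foldl (greedyStep G) Finset.univ

theorem remainingAfter_succ {V : Type*} [Fintype V] [DecidableEq V] (G : SimpleGraph V)
    [DecidableRel G.Adj] (σ : Fin (Fintype.card V) ≃ V) (k : ℕ) (hk : k < Fintype.card V) :
    remainingAfter G σ (k + 1) = greedyStep G (remainingAfter G σ k) (σ ⟨k, hk⟩) := by
  unfold remainingAfter
  rw [List.take_add_one, List.foldl_append]
  simp [hk]

theorem remainingAfter_congr {V : Type*} [Fintype V] [DecidableEq V] (G : SimpleGraph V)
    [DecidableRel G.Adj] (σ τ : Fin (Fintype.card V) ≃ V) (k : ℕ) (hk : k ≤ Fintype.card V)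
    (h : ∀ i : Fin (Fintype.card V), (i : ℕ) < k → σ i = τ i) :
    remainingAfter G σ k = remainingAfter G τ k := by
  induction k with
  | zero => simp [remainingAfter]
  | succ k ih =>
    rw [remainingAfter_succ G σ k hk, remainingAfter_succ G τ k hk,
      ih (by omega) (fun i hi => h i (by omega)), h ⟨k, hk⟩ (by simp)]

theorem greedyStep_sub {V : Type*} [Fintype V] [DecidableEq V] (G : SimpleGraph V)
    [DecidableRel G.Adj] (R : Finset V) (u : V) : greedyStep G R u ⊆ R := by
  unfold greedyStep
  split_ifs
  · exact Finset.sdiff_subset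
  · exact subset_rfl

theorem greedyStep_not_mem {V : Type*} [Fintype V] [DecidableEq V] (G : SimpleGraph V)
    [DecidableRel G.Adj] (R : Finset V) (u : V) : u ∉ greedyStep G R u := by
  unfold greedyStep
  split_ifs with h
  · simp
  · exact h

theorem remainingAfter_index {V : Type*} [Fintype V] [DecidableEq V] (G : SimpleGraph V)
    [DecidableRel G.Adj] (σ : Fin (Fintype.card V) ≃ V) (k : ℕ) (hk : k ≤ Fintype.card V)
    (i : Fin (Fintype.card V)) (hi : σ i ∈ remainingAfter G σ k) : k ≤ i := by
  induction k with
  | zero => omega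
  | succ k ih =>
    rw [remainingAfter_succ G σ k hk] at hi
    have h1 := ih (by omega) (greedyStep_sub _ _ _ hi)
    rcases Nat.lt_or_eq_of_le h1 with h | h
    · exact h
    · have : i = ⟨k, hk⟩ := Fin.ext h.symm
      subst this
      exact absurd hi (greedyStep_not_mem _ _ _)

/-- The good orders after `k` steps. -/
def goodOrders {V : Type*} [Fintype V] [DecidableEq V] (G : SimpleGraph V)
    [DecidableRel G.Adj] (v : V) (d k : ℕ) : Finset (Fin (Fintype.card V) ≃ V) :=
  Finset.univ.filter fun σ => v ∈ remainingAfter G σ k ∧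
        d ≤ ((remainingAfter G σ k).filter (G.Adj v)).card

theorem goodOrders_step {V : Type*} [Fintype V] [DecidableEq V] (G : SimpleGraph V)
    [DecidableRel G.Adj] (v : V) (d k : ℕ) (hk : k < Fintype.card V) :
    (goodOrders G v d (k + 1)).card * (Fintype.card V - k) ≤
      (goodOrders G v d k).card * (Fintype.card V - k - d) := by
  set κ : Fin (Fintype.card V) := ⟨k, hk⟩ with hκ
  set J : Finset (Fin (Fintype.card V)) := Finset.Ici κ with hJ
  have hJc : J.card = Fintype.card V - k := by simp [hJ, hκ]
  have hbound : ∀ σ ∈ goodOrders G v d k,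
      (J.filter fun j => σ j ∉ (remainingAfter G σ k).filter (G.Adj v)).card
        ≤ Fintype.card V - k - d := by
    intro σ hσ
    simp only [goodOrders, Finset.mem_filter, Finset.mem_univ, true_and] at hσ
    have h1 := Finset.card_filter_add_card_filter_not (s := J)
      (fun j => σ j ∈ (remainingAfter G σ k).filter (G.Adj v))
    have h2 : ((remainingAfter G σ k).filter (G.Adj v)).card ≤
        (J.filter fun j => σ j ∈ (remainingAfter G σ k).filter (G.Adj v)).card := by
      apply Finset.card_le_card_of_injOn σ.symm
      · intro x hx
        have hx' := hx
        simp only [Finset.coe_filter, Set.mem_ofPred_eq] at hx'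
        have := remainingAfter_index G σ k hk.le (σ.symm x) (by simpa using hx'.1)
        simp [hJ, hκ, Fin.le_def, this, hx'.1, hx'.2]
      · exact σ.symm.injective.injOn
    omega
  rw [← hJc, ← Finset.card_product]
  calc _ ≤ ((goodOrders G v d k).sigma fun σ =>
        J.filter fun j => σ j ∉ (remainingAfter G σ k).filter (G.Adj v)).card := by
        apply Finset.card_le_card_of_injOn
          (fun p => (⟨(Equiv.swap κ p.2).trans p.1, p.2⟩ :
            Σ _ : (Fin (Fintype.card V) ≃ V), Fin (Fintype.card V)))
        · rintro ⟨σ, j⟩ hp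
          simp only [Finset.coe_product, Set.mem_prod, Finset.mem_coe] at hp
          obtain ⟨hσ, hj⟩ := hp
          have hkj : k ≤ j := by simpa [hJ, hκ, Fin.le_def] using hj
          have hR : remainingAfter G ((Equiv.swap κ j).trans σ) k = remainingAfter G σ k := by
            apply remainingAfter_congr G _ _ k hk.le
            intro i hi
            have h1 : i ≠ κ := by rintro rfl; simp [hκ] at hi
            have h2 : i ≠ j := by rintro rfl; omega
            simp [Equiv.swap_apply_of_ne_of_ne h1 h2]
          simp only [goodOrders, Finset.mem_filter, Finset.mem_univ, true_and] at hσ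
          rw [remainingAfter_succ G σ k hk] at hσ
          have hsub := greedyStep_sub G (remainingAfter G σ k) (σ κ)
          simp only [Finset.coe_sigma, Set.mem_sigma_iff, Finset.mem_coe, goodOrders,
            Finset.mem_filter, Finset.mem_univ, true_and, hR]
          refine ⟨⟨hsub hσ.1, hσ.2.trans (Finset.card_le_card
            (Finset.filter_subset_filter _ hsub))⟩, hj, ?_⟩
          simp only [Equiv.trans_apply, Equiv.swap_apply_right]
          rintro ⟨h1, h2⟩
          have h3 := hσ.1
          simp only [← hκ, greedyStep, h1, if_true, Finset.mem_sdiff, Finset.mem_insert,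
            SimpleGraph.mem_neighborFinset] at h3
          exact h3.2 (Or.inr h2.symm)
        · rintro ⟨σ, j⟩ _ ⟨τ, l⟩ _ h
          simp only [Sigma.mk.injEq, heq_eq_eq] at h
          obtain ⟨h, rfl⟩ := h
          have : σ = τ := by
            ext i
            have := DFunLike.congr_fun h (Equiv.swap κ j i)
            simpa using this
          rw [this]
    _ ≤ _ := by
        rw [Finset.card_sigma]
        exact (Finset.sum_le_card_nsmul _ _ _ hbound).trans_eq (by simp [hJc])

theorem goodOrders_bound {V : Type*} [Fintype V] [DecidableEq V] (G : SimpleGraph V)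
    [DecidableRel G.Adj] (v : V) (d k : ℕ)
    (hd1 : 1 ≤ d) (hdn : d ≤ Fintype.card V) :
    ((goodOrders G v d k).card : ℝ) ≤
      (1 - (d : ℝ) / (Fintype.card V : ℝ)) ^ k * (Nat.card (Fin (Fintype.card V) ≃ V) : ℝ) := by
  have hn : (0 : ℝ) < Fintype.card V := by exact_mod_cast (by omega : 0 < Fintype.card V)
  have hq : (0 : ℝ) ≤ 1 - (d : ℝ) / (Fintype.card V : ℝ) := by
    rw [sub_nonneg, div_le_one hn]; exact_mod_cast hdn
  induction k with
  | zero =>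
    rw [pow_zero, one_mul, Nat.card_eq_fintype_card]
    exact_mod_cast Finset.card_le_univ _
  | succ k ih =>
    by_cases hk : k < Fintype.card V
    · have h := goodOrders_step G v d k hk
      suffices hs : ((goodOrders G v d (k + 1)).card : ℝ) ≤
          (1 - (d : ℝ) / (Fintype.card V : ℝ)) * (goodOrders G v d k).card by
        calc _ ≤ _ := hs
          _ ≤ _ := mul_le_mul_of_nonneg_left ih hq
          _ = _ := by ring
      have hm : (0 : ℝ) < ((Fintype.card V - k : ℕ) : ℝ) := by
        exact_mod_cast (by omega : 0 < Fintype.card V - k)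
      have hmn : ((Fintype.card V - k : ℕ) : ℝ) ≤ Fintype.card V := by
        exact_mod_cast Nat.sub_le _ _
      generalize Fintype.card V - k = m at *
      have h' : ((goodOrders G v d (k + 1)).card : ℝ) * m ≤
        (goodOrders G v d k).card * ((m - d : ℕ) : ℝ) := by exact_mod_cast h
      have hmd : ((m - d : ℕ) : ℝ) ≤ (1 - (d : ℝ) / (Fintype.card V : ℝ)) * m := by
        rcases le_total d m with hdm | hdm
        · rw [Nat.cast_sub hdm, sub_mul, one_mul]
          have : (d : ℝ) / (Fintype.card V : ℝ) * m ≤ d := by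
            rw [div_mul_eq_mul_div, div_le_iff₀ hn]
            exact mul_le_mul_of_nonneg_left hmn (Nat.cast_nonneg d)
          linarith
        · rw [Nat.sub_eq_zero_of_le hdm]
          simpa using mul_nonneg hq hm.le
      refine le_of_mul_le_mul_right ?_ hm
      calc _ ≤ _ := h'
        _ ≤ _ := mul_le_mul_of_nonneg_left hmd (Nat.cast_nonneg _)
        _ = _ := by ring
    · have : goodOrders G v d (k + 1) = ∅ := by
        apply Finset.filter_eq_empty_iff.2
        rintro σ - ⟨h, -⟩
        have he : remainingAfter G σ (k + 1) = remainingAfter G σ (Fintype.card V) := by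
          unfold remainingAfter
          rw [List.take_of_length_le (by simp; omega), List.take_of_length_le (by simp)]
        rw [he, ← σ.apply_symm_apply v] at h
        have := remainingAfter_index G σ _ le_rfl _ h
        omega
      rw [this]
      simp only [Finset.card_empty, Nat.cast_zero]
      positivity

/-- For the random greedy MIS (vertices processed in a uniformly random order),
the probability that after `k` steps a fixed vertex `v` is still present with
current degree at least `d` is at most `(1 − d/n)^k`. -/
theorem stmt13 {V : Type*} [Fintype V] [DecidableEq V] (G : SimpleGraph V)
    [DecidableRel G.Adj] (v : V) (d k : ℕ)
    (hd1 : 1 ≤ d) (hdn : d ≤ Fintype.card V) :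
    (Nat.card {σ : Fin (Fintype.card V) ≃ V //
        v ∈ remainingAfter G σ k ∧
        d ≤ ((remainingAfter G σ k).filter (G.Adj v)).card} : ℝ) /
      (Nat.card (Fin (Fintype.card V) ≃ V) : ℝ) ≤
      (1 - (d : ℝ) / (Fintype.card V : ℝ)) ^ k := by
  classical
  have hN : (0 : ℝ) < (Nat.card (Fin (Fintype.card V) ≃ V) : ℝ) := by
    have : Nonempty (Fin (Fintype.card V) ≃ V) := ⟨(Fintype.equivFin V).symm⟩
    exact_mod_cast Nat.card_pos
  rw [div_le_iff₀ hN]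
  refine le_trans (le_of_eq ?_) (goodOrders_bound G v d k hd1 hdn)
  rw [Nat.card_eq_fintype_card, Fintype.card_subtype]
  rfl
end
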